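/- Let d, n be positive integers with d ≤ n < 2d+1, and set l := 2d+1−n. For every unitary matrix U ∈ U(n+1) there exist a real orthogonal matrix A ∈ O(n+1;ℝ), unitary matrices U₁ ∈ U(d+1) and U₂ ∈ U(n−d), and real numbers a₀, …, a_{d−l} ∈ [0,2π] such that U = A · M · diag(U₁, U₂), where M is the (n+1)×(n+1) block matrix M = [[Λ₁, 0, Λ₂], [Λ₂, 0, Λ₁], [0, Id_l, 0]] with Λ₁ = diag(cos a₀, …, cos a_{d−l}) and Λ₂ = diag(√−1·sin a₀, …, √−1·sin a_{d−l}) both of size n−d (the row blocks of M have sizes n−d, n−d, l and the column blocks have sizes n−d, l, n−d), and diag(U₁,U₂) is the block-diagonal (n+1)×(n+1) matrix with blocks U₁ of size d+1 and U₂ of size n−d. -/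

import Mathlib

open Matrix

/-- A complex square matrix is real orthogonal if it has real entries and `ᵗA·A = 1`. -/
def IsRealOrthogonal {N : ℕ} (A : Matrix (Fin N) (Fin N) ℂ) : Prop :=
  (∀ i j, (A i j).im = 0) ∧ Aᵀ * A = 1

/-- For `d ≤ n < 2d+1` with `l := 2d+1−n` and `r := n−d` (so `d−l = r−1`), the `(n+1)×(n+1)`
block matrix `[[Λ₁, 0, Λ₂], [Λ₂, 0, Λ₁], [0, Id_l, 0]]`, where the row blocks have sizes
`r, r, l`, the column blocks have sizes `r, l, r`, and `Λ₁ = diag(cos a₀, …, cos a_{d−l})`,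
`Λ₂ = diag(√−1 sin a₀, …, √−1 sin a_{d−l})` are of size `r = n−d`. -/
noncomputable def middleBlock' (d n : ℕ) (a : ℕ → ℝ) : Matrix (Fin (n+1)) (Fin (n+1)) ℂ :=
  fun i j =>
    if (i : ℕ) < n - d ∧ (j : ℕ) = (i : ℕ) then (Real.cos (a i) : ℂ)
    else if (i : ℕ) < n - d ∧ (j : ℕ) = (i : ℕ) + (n - d) + (2*d+1-n) then
      Complex.I * (Real.sin (a i) : ℂ)
    else if n - d ≤ (i : ℕ) ∧ (i : ℕ) < 2*(n-d) ∧ (j : ℕ) + (n - d) = (i : ℕ) then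
      Complex.I * (Real.sin (a j) : ℂ)
    else if n - d ≤ (i : ℕ) ∧ (i : ℕ) < 2*(n-d) ∧ (j : ℕ) = (i : ℕ) + (2*d+1-n) then
      (Real.cos (a ((i : ℕ) - (n - d))) : ℂ)
    else if 2*(n-d) ≤ (i : ℕ) ∧ (j : ℕ) + (n - d) = (i : ℕ) then 1
    else 0

/-- The `(n+1)×(n+1)` block-diagonal matrix `diag(U₁, U₂)` with blocks of sizes `d+1`, `n−d`. -/
def blockDiagTwo (d n : ℕ) (U₁ : Matrix (Fin (d+1)) (Fin (d+1)) ℂ)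
    (U₂ : Matrix (Fin (n-d)) (Fin (n-d)) ℂ) : Matrix (Fin (n+1)) (Fin (n+1)) ℂ :=
  fun i j =>
    if h : (i : ℕ) < d+1 ∧ (j : ℕ) < d+1 then U₁ ⟨i, h.1⟩ ⟨j, h.2⟩
    else if h' : d+1 ≤ (i : ℕ) ∧ d+1 ≤ (j : ℕ) then
      U₂ ⟨(i : ℕ) - (d+1), by have := i.isLt; omega⟩ ⟨(j : ℕ) - (d+1), by have := j.isLt; omega⟩
    else 0

/-- A symmetric bilinear form on a nonzero finite-dimensional real inner product space is
represented by the inner product, up to a scalar, along some unit vector. -/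
theorem exists_unit_eigenvector_of_symm_form {E : Type*} [NormedAddCommGroup E]
    [InnerProductSpace ℝ E] [FiniteDimensional ℝ E] [Nontrivial E] (B : E →ₗ[ℝ] E →ₗ[ℝ] ℝ)
    (hB : ∀ x y, B x y = B y x) :
    ∃ v : E, ‖v‖ = 1 ∧ ∃ μ : ℝ, ∀ w, B v w = μ * inner ℝ v w := by
  let T : E →ₗ[ℝ] E :=
    { toFun := fun x => (InnerProductSpace.toDual ℝ E).symm (LinearMap.toContinuousLinearMap (B x))
      map_add' := by intro x y; simp
      map_smul' := by intro c x; simp }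
  have hT : ∀ x y, inner ℝ (T x) y = B x y := fun x y => by
    simp only [T, LinearMap.coe_mk, AddHom.coe_mk, InnerProductSpace.toDual_symm_apply,
      LinearMap.coe_toContinuousLinearMap']
  have hsymm : T.IsSymmetric := fun x y => by
    rw [hT, real_inner_comm, hT, hB]
  obtain ⟨μ, hμ⟩ : ∃ μ : ℝ, Module.End.HasEigenvalue T μ :=
    ⟨_, hsymm.hasEigenvalue_iSup_of_finiteDimensional⟩
  obtain ⟨x, hx⟩ := hμ.exists_hasEigenvector
  have hx0 : ‖x‖ ≠ 0 := norm_ne_zero_iff.2 hx.2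
  refine ⟨‖x‖⁻¹ • x, by simp [norm_smul, hx0], μ, fun w => ?_⟩
  rw [map_smul, LinearMap.smul_apply, ← hT, hx.apply_eq_smul, inner_smul_left, inner_smul_left,
    smul_eq_mul]
  simp only [RCLike.conj_to_real]
  ring

/-- A symmetric complex bilinear form on a nonzero finite-dimensional complex inner product space
has a unit vector on which it is real and whose orthogonal complement it annihilates. -/
theorem exists_unit_coneigenvector {E : Type*} [NormedAddCommGroup E]
    [InnerProductSpace ℂ E] [FiniteDimensional ℂ E] [Nontrivial E] (B : E →ₗ[ℂ] E →ₗ[ℂ] ℂ)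
    (hB : ∀ x y, B x y = B y x) :
    ∃ v : E, ‖v‖ = 1 ∧ (B v v).im = 0 ∧ ∀ w, inner ℂ v w = 0 → B v w = 0 := by
  let : InnerProductSpace ℝ E := InnerProductSpace.complexToReal
  have : FiniteDimensional ℝ E := FiniteDimensional.complexToReal E
  let B' : E →ₗ[ℝ] E →ₗ[ℝ] ℝ := LinearMap.mk₂ ℝ (fun x y => (B x y).re)
    (by simp) (by
      intro c x y
      rw [← Complex.coe_smul]
      simp) (by simp) (by
      intro c x y
      rw [← Complex.coe_smul]
      simp)
  obtain ⟨v, hv, μ, h⟩ := exists_unit_eigenvector_of_symm_form (E := E) B'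
    (fun x y => by simp [B', hB x y])
  have h' : ∀ w, (B v w).re = μ * (inner ℂ v w).re := fun w => h w
  have h'' : ∀ w, -(B v w).im = μ * -(inner ℂ v w).im := fun w => by
    simpa [inner_smul_right] using h' (Complex.I • w)
  refine ⟨v, hv, ?_, fun w hw => ?_⟩
  · simpa [inner_self_eq_norm_sq_to_K, ← Complex.ofReal_pow] using h'' v
  · apply Complex.ext
    · simpa [hw] using h' w
    · simpa [hw] using h'' w

/-- **Takagi factorization**: a symmetric complex bilinear form is real diagonal in a suitable
orthonormal basis. -/
theorem exists_orthonormal_real_diagonal {E : Type*} [NormedAddCommGroup E]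
    [InnerProductSpace ℂ E] [FiniteDimensional ℂ E] (r : ℕ) (hr : Module.finrank ℂ E = r)
    (B : E →ₗ[ℂ] E →ₗ[ℂ] ℂ) (hB : ∀ x y, B x y = B y x) :
    ∃ b : Fin r → E, Orthonormal ℂ b ∧ (∀ i, (B (b i) (b i)).im = 0) ∧
      ∀ i j, i ≠ j → B (b i) (b j) = 0 := by
  induction r generalizing E with
  | zero => exact ⟨Fin.elim0, ⟨fun i => i.elim0, fun i => i.elim0⟩, fun i => i.elim0,
      fun i => i.elim0⟩
  | succ r ih =>
    have : Nontrivial E := Module.finrank_pos_iff (R := ℂ).1 (by omega)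
    obtain ⟨v, hv, hvr, hvo⟩ := exists_unit_coneigenvector B hB
    have hv0 : v ≠ 0 := by rintro rfl; simp at hv
    let K : Submodule ℂ E := (ℂ ∙ v)ᗮ
    have hK : Module.finrank ℂ K = r := by
      have := (ℂ ∙ v).finrank_add_finrank_orthogonal
      rw [finrank_span_singleton hv0] at this
      change Module.finrank ℂ (ℂ ∙ v)ᗮ = r
      omega
    obtain ⟨b, hb, hbr, hbo⟩ := ih hK (B.compl₁₂ K.subtype K.subtype) (fun x y => hB _ _)
    have hperp : ∀ i, inner ℂ v (b i : E) = 0 := fun i =>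
      Submodule.mem_orthogonal_singleton_iff_inner_right.1 (b i).2
    refine ⟨Matrix.vecCons v (fun i => (b i : E)),
      orthonormal_vecCons_iff.2 ⟨hv, hperp, hb.comp_linearIsometry K.subtypeₗᵢ⟩, ?_, ?_⟩
    · intro i
      cases i using Fin.cases with
      | zero => exact hvr
      | succ i => exact hbr i
    · intro i j hij
      cases i using Fin.cases with
      | zero =>
        cases j using Fin.cases with
        | zero => exact absurd rfl hij
        | succ j => exact hvo _ (hperp j)
      | succ i =>
        cases j using Fin.cases with
        | zero => exact (hB _ _).trans (hvo _ (hperp i))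
        | succ j => exact hbo i j (fun h => hij (h ▸ rfl))

/-- Pairwise orthogonal vectors, as many as the dimension, are the multiples by their norms of the
vectors of an orthonormal basis. -/
theorem exists_orthonormalBasis_norm_smul {E ι : Type*} [NormedAddCommGroup E]
    [InnerProductSpace ℝ E] [FiniteDimensional ℝ E] [Fintype ι]
    (hι : Module.finrank ℝ E = Fintype.card ι) (v : ι → E)
    (hv : ∀ i j, i ≠ j → inner ℝ (v i) (v j) = 0) :
    ∃ b : OrthonormalBasis ι ℝ E, ∀ i, v i = ‖v i‖ • b i := by
  obtain ⟨b, hb⟩ := Orthonormal.exists_orthonormalBasis_extension_of_card_eq hι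
    (v := fun i => ‖v i‖⁻¹ • v i) (s := {i | v i ≠ 0})
    ⟨fun i => by
      have := norm_ne_zero_iff.2 i.2
      simp [norm_smul, this],
    fun i j hij => by
      have := hv i j (fun h => hij (Subtype.ext h))
      simp [inner_smul_left, inner_smul_right, this]⟩
  refine ⟨b, fun i => ?_⟩
  by_cases h : v i = 0
  · simp [h]
  · rw [hb i h, smul_smul, mul_inv_cancel₀ (norm_ne_zero_iff.2 h), one_smul]

/-- The columns of a complex matrix can be recombined unitarily so that their products under the
standard symmetric bilinear form are real and diagonal. -/
theorem exists_unitary_mul_transpose_mul_real_diagonal {ι : Type*} [Fintype ι] {r : ℕ}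
    (V : Matrix ι (Fin r) ℂ) :
    ∃ Q : Matrix (Fin r) (Fin r) ℂ, Qᴴ * Q = 1 ∧
      (∀ i, (((V * Q)ᵀ * (V * Q)) i i).im = 0) ∧
      ∀ i j, i ≠ j → ((V * Q)ᵀ * (V * Q)) i j = 0 := by
  let L : EuclideanSpace ℂ (Fin r) →ₗ[ℂ] (Fin r → ℂ) :=
    (WithLp.linearEquiv 2 ℂ (Fin r → ℂ)).toLinearMap
  let B := (Matrix.toBilin' (Vᵀ * V)).compl₁₂ L L
  have hB : ∀ x y, B x y = B y x := fun x y => by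
    simp only [B, LinearMap.compl₁₂_apply, Matrix.toBilin'_apply']
    rw [dotProduct_comm, ← Matrix.vecMul_transpose, ← Matrix.dotProduct_mulVec]
    simp
  obtain ⟨b, hb, hbr, hbo⟩ := exists_orthonormal_real_diagonal r (by simp) B hB
  have key : ∀ i j, ((V * Matrix.of fun k l => b l k)ᵀ * (V * Matrix.of fun k l => b l k)) i j
      = B (b i) (b j) := fun i j => by
    simp only [B, LinearMap.compl₁₂_apply, Matrix.toBilin'_apply']
    rw [Matrix.transpose_mul, Matrix.mul_assoc, ← Matrix.mul_assoc Vᵀ]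
    rfl
  refine ⟨Matrix.of fun k l => b l k, ?_, fun i => by rw [key, hbr],
    fun i j hij => by rw [key, hbo i j hij]⟩
  ext i j
  have h := orthonormal_iff_ite.1 hb i j
  rw [Matrix.one_apply, ← h, PiLp.inner_apply, Matrix.mul_apply]
  exact Finset.sum_congr rfl fun k _ => by simp [mul_comm]

/-- Real and imaginary parts of orthonormal complex columns with real diagonal products under the
standard symmetric bilinear form are pairwise orthogonal. -/
theorem re_im_columns_orthogonal {ι κ : Type*} [Fintype ι] [DecidableEq κ] (W : Matrix ι κ ℂ)
    (hW : ∀ i j, (Wᴴ * W) i j = if i = j then 1 else 0)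
    (hr : ∀ i, ((Wᵀ * W) i i).im = 0) (ho : ∀ i j, i ≠ j → (Wᵀ * W) i j = 0) :
    (∀ i j, i ≠ j → ∑ k, (W k i).re * (W k j).re = 0) ∧
    (∀ i j, i ≠ j → ∑ k, (W k i).im * (W k j).im = 0) ∧
    (∀ i j, ∑ k, (W k i).re * (W k j).im = 0) ∧
    ∀ i, ∑ k, (W k i).re * (W k i).re + ∑ k, (W k i).im * (W k i).im = 1 := by
  have h1 : ∀ i j, ∑ k, (W k i).re * (W k j).re + ∑ k, (W k i).im * (W k j).im
      = if i = j then 1 else 0 := fun i j => by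
    have := congrArg Complex.re (hW i j)
    simp only [Matrix.mul_apply, Matrix.conjTranspose_apply, Complex.re_sum] at this
    rw [← Finset.sum_add_distrib]
    simpa [apply_ite Complex.re] using this
  have h2 : ∀ i j, ∑ k, (W k i).re * (W k j).im - ∑ k, (W k i).im * (W k j).re = 0 :=
      fun i j => by
    have := congrArg Complex.im (hW i j)
    simp only [Matrix.mul_apply, Matrix.conjTranspose_apply, Complex.im_sum] at this
    rw [← Finset.sum_sub_distrib]
    simpa [apply_ite Complex.im, ← sub_eq_add_neg] using this
  have h3 : ∀ i j, i ≠ j →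
      ∑ k, (W k i).re * (W k j).re - ∑ k, (W k i).im * (W k j).im = 0 := fun i j hij => by
    have := congrArg Complex.re (ho i j hij)
    simp only [Matrix.mul_apply, Matrix.transpose_apply, Complex.re_sum] at this
    rw [← Finset.sum_sub_distrib]
    simpa using this
  have h4 : ∀ i j, ∑ k, (W k i).re * (W k j).im + ∑ k, (W k i).im * (W k j).re = 0 :=
      fun i j => by
    have : ((Wᵀ * W) i j).im = 0 := by
      by_cases hij : i = j
      · rw [hij, hr]
      · rw [ho i j hij, Complex.zero_im]
    simp only [Matrix.mul_apply, Matrix.transpose_apply, Complex.im_sum] at this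
    rw [← Finset.sum_add_distrib]
    simpa using this
  refine ⟨fun i j hij => ?_, fun i j hij => ?_, fun i j => ?_, fun i => by simpa using h1 i i⟩
  · have := h1 i j
    rw [if_neg hij] at this
    linarith [h3 i j hij]
  · have := h1 i j
    rw [if_neg hij] at this
    linarith [h3 i j hij]
  · linarith [h2 i j, h4 i j]

/-- Orthonormal complex columns have the form `(X · i S + Y · C) Q` with `Q` unitary, `[X, Y]`
extending to a real orthogonal matrix, and `S`, `C` the diagonal matrices of sines and cosines. -/
theorem exists_real_orthonormal_sin_cos {m r l : ℕ} (hm : r + (r + l) = m)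
    (V : Matrix (Fin m) (Fin r) ℂ) (hV : Vᴴ * V = 1) :
    ∃ (b : OrthonormalBasis (Fin r ⊕ (Fin r ⊕ Fin l)) ℝ (EuclideanSpace ℝ (Fin m)))
      (Q : Matrix (Fin r) (Fin r) ℂ) (t : Fin r → ℝ), Qᴴ * Q = 1 ∧
      (∀ j, t j ∈ Set.Icc 0 (2 * Real.pi)) ∧
      ∀ i j, (V * Q) i j = (b (.inl j) i : ℂ) * (Complex.I * Real.sin (t j)) +
        (b (.inr (.inl j)) i : ℂ) * Real.cos (t j) := by
  obtain ⟨Q, hQ, hr, ho⟩ := exists_unitary_mul_transpose_mul_real_diagonal V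
  have hW : (V * Q)ᴴ * (V * Q) = 1 := by
    rw [Matrix.conjTranspose_mul, Matrix.mul_assoc, ← Matrix.mul_assoc Vᴴ, hV, Matrix.one_mul, hQ]
  generalize hVQ : V * Q = W at hr ho hW
  obtain ⟨hp, hq, hpq, hn⟩ := re_im_columns_orthogonal W
    (fun i j => by rw [hW, Matrix.one_apply]) hr ho
  let p : Fin r → EuclideanSpace ℝ (Fin m) := fun j => WithLp.toLp 2 fun i => (W i j).re
  let q : Fin r → EuclideanSpace ℝ (Fin m) := fun j => WithLp.toLp 2 fun i => (W i j).im
  have hin : ∀ x y : EuclideanSpace ℝ (Fin m), inner ℝ x y = ∑ k, x k * y k := fun x y => by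
    rw [PiLp.inner_apply]
    exact Finset.sum_congr rfl fun k _ => by simp [mul_comm]
  have hpq' : ∀ i j, inner ℝ (p i) (q j) = 0 := fun i j => (hin _ _).trans (hpq i j)
  obtain ⟨b, hb⟩ := exists_orthonormalBasis_norm_smul (E := EuclideanSpace ℝ (Fin m))
    (ι := Fin r ⊕ (Fin r ⊕ Fin l)) (by simp [hm])
    (Sum.elim q (Sum.elim p fun _ => 0)) (by
      rintro (i | i | i) (j | j | j) hij
      · exact (hin _ _).trans (hq i j fun h => hij (h ▸ rfl))
      · exact (real_inner_comm _ _).trans (hpq' j i)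
      · exact inner_zero_right _
      · exact hpq' i j
      · exact (hin _ _).trans (hp i j fun h => hij (h ▸ rfl))
      · exact inner_zero_right _
      · exact inner_zero_left _
      · exact inner_zero_left _
      · exact inner_zero_left _)
  have hnorm : ∀ j, ‖p j‖ ^ 2 + ‖q j‖ ^ 2 = 1 := fun j => by
    rw [← real_inner_self_eq_norm_sq, ← real_inner_self_eq_norm_sq, hin, hin]
    exact hn j
  have hcos : ∀ j, Real.cos (Real.arccos ‖p j‖) = ‖p j‖ := fun j =>
    Real.cos_arccos (by linarith [norm_nonneg (p j)])
      (by nlinarith [hnorm j, norm_nonneg (p j), sq_nonneg ‖q j‖])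
  have hsin : ∀ j, Real.sin (Real.arccos ‖p j‖) = ‖q j‖ := fun j => by
    rw [Real.sin_arccos, ← Real.sqrt_sq (norm_nonneg (q j))]
    congr 1
    linarith [hnorm j]
  refine ⟨b, Q, fun j => Real.arccos ‖p j‖, hQ, fun j => ⟨Real.arccos_nonneg _, ?_⟩,
    fun i j => ?_⟩
  · linarith [Real.arccos_le_pi ‖p j‖, Real.pi_pos]
  · have h1 : (W i j).im = ‖q j‖ * b (.inl j) i := congrArg (fun x => x i) (hb (.inl j))
    have h2 : (W i j).re = ‖p j‖ * b (.inr (.inl j)) i := congrArg (fun x => x i) (hb (.inr (.inl j)))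
    rw [hVQ, hcos, hsin]
    apply Complex.ext
    · simp [h2, mul_comm]
    · simp [h1, mul_comm]

/-- The middle block matrix, with rows and columns indexed by its blocks. -/
noncomputable def middleSum (r l : ℕ) (t : Fin r → ℝ) :
    Matrix (Fin r ⊕ (Fin r ⊕ Fin l)) ((Fin r ⊕ Fin l) ⊕ Fin r) ℂ :=
  let C : Matrix (Fin r) (Fin r) ℂ := diagonal fun i => (Real.cos (t i) : ℂ)
  let S : Matrix (Fin r) (Fin r) ℂ := diagonal fun i => Complex.I * (Real.sin (t i) : ℂ)
  fromBlocks (fromCols C 0) S (fromBlocks S 0 0 1) (fromRows C 0)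

theorem conjTranspose_middleSum_mul_self (r l : ℕ) (t : Fin r → ℝ) :
    (middleSum r l t)ᴴ * middleSum r l t = 1 := by
  have h : ∀ x : ℝ, Complex.cos x * Complex.cos x + Complex.sin x * Complex.sin x = 1 :=
    fun x => by linear_combination Complex.cos_sq_add_sin_sq x
  have h' : ∀ x : ℝ, Complex.sin x * Complex.sin x + Complex.cos x * Complex.cos x = 1 :=
    fun x => by linear_combination Complex.cos_sq_add_sin_sq x
  have hc : ∀ x : ℝ, (starRingEnd ℂ) (Complex.cos x) = Complex.cos x := fun x => by
    rw [← Complex.ofReal_cos, Complex.conj_ofReal]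
  have hs : ∀ x : ℝ, (starRingEnd ℂ) (Complex.sin x) = Complex.sin x := fun x => by
    rw [← Complex.ofReal_sin, Complex.conj_ofReal]
  have hI : ∀ x y : ℂ, Complex.I * x * (Complex.I * y) = -(x * y) := fun x y => by
    linear_combination x * y * Complex.I_mul_I
  ext ((i | i) | i) ((j | j) | j)
  case inl.inl.inl.inr | inl.inr.inl.inl | inl.inr.inr | inr.inl.inr =>
    simp [middleSum, Matrix.mul_apply, Matrix.diagonal_apply, Matrix.one_apply]
  all_goals
    obtain rfl | hij := eq_or_ne i j
    · simp [middleSum, Matrix.mul_apply, Matrix.diagonal_apply, Matrix.one_apply, hc, hs, hI, h, h']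
      try ring
    · simp [middleSum, Matrix.mul_apply, Matrix.diagonal_apply, Matrix.one_apply, hij, hij.symm]

/-- The row blocks of the middle matrix. -/
def rowEquiv {d n : ℕ} (hdn : d ≤ n) (hn : n < 2 * d + 1) :
    Fin (n - d) ⊕ (Fin (n - d) ⊕ Fin (2 * d + 1 - n)) ≃ Fin (n + 1) :=
  ((Equiv.sumCongr (Equiv.refl _) finSumFinEquiv).trans finSumFinEquiv).trans
    (finCongr (by omega))

/-- The splitting of the indices into the first `d + 1` and the last `n - d`. -/
def splitEquiv {d n : ℕ} (hdn : d ≤ n) : Fin (d + 1) ⊕ Fin (n - d) ≃ Fin (n + 1) :=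
  finSumFinEquiv.trans (finCongr (by omega))

/-- The column blocks of the middle matrix. -/
def colEquiv {d n : ℕ} (hdn : d ≤ n) (hn : n < 2 * d + 1) :
    (Fin (n - d) ⊕ Fin (2 * d + 1 - n)) ⊕ Fin (n - d) ≃ Fin (n + 1) :=
  (Equiv.sumCongr (finSumFinEquiv.trans (finCongr (by omega))) (Equiv.refl _)).trans
    (splitEquiv hdn)

theorem middleBlock'_submatrix {d n : ℕ} (hdn : d ≤ n) (hn : n < 2 * d + 1) (a : ℕ → ℝ) :
    (middleBlock' d n a).submatrix (rowEquiv hdn hn) (colEquiv hdn hn) =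
      middleSum (n - d) (2 * d + 1 - n) fun i => a i := by
  ext (⟨i, hi⟩ | ⟨i, hi⟩ | ⟨i, hi⟩) ((⟨j, hj⟩ | ⟨j, hj⟩) | ⟨j, hj⟩) <;>
    simp only [Matrix.submatrix_apply, middleBlock', middleSum, rowEquiv, colEquiv, splitEquiv,
      Equiv.trans_apply, Equiv.sumCongr_apply, Sum.map_inl, Sum.map_inr, Equiv.refl_apply,
      finSumFinEquiv_apply_left, finSumFinEquiv_apply_right, finCongr_apply, Fin.val_cast,
      Fin.val_castAdd, Fin.val_natAdd, fromBlocks_apply₁₁, fromBlocks_apply₁₂, fromBlocks_apply₂₁,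
      fromBlocks_apply₂₂, fromCols_apply_inl, fromCols_apply_inr, fromRows_apply_inl,
      fromRows_apply_inr,
      diagonal_apply, Matrix.one_apply, Matrix.zero_apply, Fin.mk.injEq,
      Nat.add_sub_cancel_left] <;>
    split_ifs <;> first | rfl | omega | (subst_vars; rfl)

theorem blockDiagTwo_submatrix {d n : ℕ} (hdn : d ≤ n) (U₁ : Matrix (Fin (d+1)) (Fin (d+1)) ℂ)
    (U₂ : Matrix (Fin (n-d)) (Fin (n-d)) ℂ) :
    (blockDiagTwo d n U₁ U₂).submatrix (splitEquiv hdn) (splitEquiv hdn) =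
      fromBlocks U₁ 0 0 U₂ := by
  ext (⟨i, hi⟩ | ⟨i, hi⟩) (⟨j, hj⟩ | ⟨j, hj⟩)
  · simp [blockDiagTwo, splitEquiv, hi, hj]
  · have h₁ : ¬d + 1 + j ≤ d := by omega
    have h₂ : ¬d < i := by omega
    simp [blockDiagTwo, splitEquiv, h₁, h₂]
  · have h₁ : ¬d + 1 + i ≤ d := by omega
    have h₂ : ¬d < j := by omega
    simp [blockDiagTwo, splitEquiv, h₁, h₂]
  · have h₁ : ¬d + 1 + i ≤ d := by omega
    simp [blockDiagTwo, splitEquiv, h₁]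

theorem conjTranspose_middleBlock'_mul_self {d n : ℕ} (hdn : d ≤ n) (hn : n < 2 * d + 1)
    (a : ℕ → ℝ) : (middleBlock' d n a)ᴴ * middleBlock' d n a = 1 := by
  have h := conjTranspose_middleSum_mul_self (n - d) (2 * d + 1 - n) fun i => a i
  rw [← middleBlock'_submatrix hdn hn, Matrix.conjTranspose_submatrix,
    Matrix.submatrix_mul_equiv] at h
  have := congrArg (fun X => X.submatrix (colEquiv hdn hn).symm (colEquiv hdn hn).symm) h
  simpa using this

/-- A block lower triangular unitary matrix is block diagonal, with unitary first block. -/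
theorem unitary_of_fromBlocks_zero {m n : Type*} [Fintype m] [Fintype n] [DecidableEq m]
    [DecidableEq n] {X : Matrix m m ℂ} {Y : Matrix n m ℂ} {Z : Matrix n n ℂ}
    (h : (fromBlocks X 0 Y Z)ᴴ * fromBlocks X 0 Y Z = 1) : Xᴴ * X = 1 ∧ Y = 0 := by
  have h' := mul_eq_one_comm.1 h
  rw [fromBlocks_conjTranspose, fromBlocks_multiply, ← fromBlocks_one, fromBlocks_inj] at h'
  obtain ⟨hX, -, hY, -⟩ := h'
  simp only [conjTranspose_zero, Matrix.mul_zero, add_zero] at hX hY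
  have hX' := mul_eq_one_comm.1 hX
  refine ⟨hX', ?_⟩
  rw [← Matrix.mul_one Y, ← hX', ← Matrix.mul_assoc, hY, Matrix.zero_mul]

theorem isRealOrthogonal_of_orthonormalBasis {N : ℕ} {ι : Type*} [Fintype ι]
    (b : OrthonormalBasis ι ℝ (EuclideanSpace ℝ (Fin N))) (e : Fin N ≃ ι) :
    IsRealOrthogonal (Matrix.of fun i k => (b (e k) i : ℂ)) := by
  classical
  refine ⟨fun i j => Complex.ofReal_im _, ?_⟩
  ext j k
  have h := orthonormal_iff_ite.1 b.orthonormal (e j) (e k)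
  rw [PiLp.inner_apply] at h
  rw [Matrix.mul_apply, Matrix.one_apply]
  simp only [e.apply_eq_iff_eq] at h
  have := congrArg (Complex.ofReal) h
  simpa [mul_comm, apply_ite Complex.ofReal] using this

/-- decomposition of a unitary matrix `U ∈ U(n+1)` when `d ≤ n < 2d+1`:
`U = A · M · diag(U₁,U₂)` with `A` real orthogonal, `U₁ ∈ U(d+1)`, `U₂ ∈ U(n−d)`, and `M` the
block matrix `[[Λ₁, 0, Λ₂], [Λ₂, 0, Λ₁], [0, Id_l, 0]]` for some `a₀, …, a_{d−l} ∈ [0, 2π]`,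
where `l = 2d+1−n`. -/
theorem stmt1 (d n : ℕ) (hd : 0 < d) (hdn : d ≤ n) (hn : n < 2*d+1)
    (U : Matrix (Fin (n+1)) (Fin (n+1)) ℂ) (hU : Uᴴ * U = 1) :
    ∃ (A : Matrix (Fin (n+1)) (Fin (n+1)) ℂ) (U₁ : Matrix (Fin (d+1)) (Fin (d+1)) ℂ)
      (U₂ : Matrix (Fin (n-d)) (Fin (n-d)) ℂ) (a : ℕ → ℝ),
      IsRealOrthogonal A ∧ U₁ᴴ * U₁ = 1 ∧ U₂ᴴ * U₂ = 1 ∧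
      (∀ j ≤ d - (2*d+1-n), a j ∈ Set.Icc (0:ℝ) (2 * Real.pi)) ∧
      U = A * middleBlock' d n a * blockDiagTwo d n U₁ U₂ := by

  let V := U.submatrix id (fun j => splitEquiv hdn (.inr j))
  have hV : Vᴴ * V = 1 := by
    ext i j
    have h := congrFun₂ hU (splitEquiv hdn (.inr i)) (splitEquiv hdn (.inr j))
    simpa [V, Matrix.mul_apply, Matrix.one_apply] using h
  obtain ⟨b, Q, t, hQ, ht, hVQ⟩ := exists_real_orthonormal_sin_cos
    (l := 2 * d + 1 - n) (by omega) V hV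
  let a : ℕ → ℝ := fun k => if h : k < n - d then t ⟨k, h⟩ else 0
  have ha : (fun i : Fin (n - d) => a i) = t := by
    funext i
    simp [a]
  let A : Matrix (Fin (n+1)) (Fin (n+1)) ℂ :=
    Matrix.of fun i k => (b ((rowEquiv hdn hn).symm k) i : ℂ)
  have hA : IsRealOrthogonal A := isRealOrthogonal_of_orthonormalBasis b (rowEquiv hdn hn).symm
  have hAH : Aᴴ = Aᵀ := by
    ext i j
    exact Complex.conj_eq_iff_im.2 (hA.1 j i)
  let N := A * middleBlock' d n a
  have hN : Nᴴ * N = 1 := by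
    rw [Matrix.conjTranspose_mul, Matrix.mul_assoc, ← Matrix.mul_assoc Aᴴ, hAH, hA.2,
      Matrix.one_mul, conjTranspose_middleBlock'_mul_self hdn hn]
  have hcol : N.submatrix id (fun j => splitEquiv hdn (.inr j)) = V * Q := by
    ext i j
    have hM : ∀ x, middleBlock' d n a (rowEquiv hdn hn x) (splitEquiv hdn (.inr j)) =
        middleSum (n - d) (2 * d + 1 - n) t x (.inr j) := fun x => by
      rw [← ha, ← middleBlock'_submatrix hdn hn]
      rfl
    rw [hVQ, Matrix.submatrix_apply, id_eq, show N = A * middleBlock' d n a from rfl,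
      Matrix.mul_apply, ← (rowEquiv hdn hn).sum_comp]
    simp [hM, A, middleSum, Matrix.diagonal_apply]
  let G := Nᴴ * U
  have hG : Gᴴ * G = 1 := by
    rw [Matrix.conjTranspose_mul, Matrix.conjTranspose_conjTranspose, Matrix.mul_assoc,
      ← Matrix.mul_assoc N, mul_eq_one_comm.1 hN, Matrix.one_mul, hU]
  have hlast : G.submatrix id (fun j => splitEquiv hdn (.inr j)) =
      (1 : Matrix (Fin (n+1)) (Fin (n+1)) ℂ).submatrix id (fun j => splitEquiv hdn (.inr j)) *
        Qᴴ := by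
    have hVN : V = N.submatrix id (fun j => splitEquiv hdn (.inr j)) * Qᴴ := by
      rw [hcol, Matrix.mul_assoc, mul_eq_one_comm.1 hQ, Matrix.mul_one]
    calc _ = Nᴴ * V := rfl
      _ = (Nᴴ * N).submatrix id (fun j => splitEquiv hdn (.inr j)) * Qᴴ := by
        rw [hVN, ← Matrix.mul_assoc]
        rfl
      _ = _ := by rw [hN]
  let G' := G.submatrix (splitEquiv hdn) (splitEquiv hdn)
  have h12 : G'.toBlocks₁₂ = 0 := by
    ext i j
    have h := congrFun₂ hlast (splitEquiv hdn (.inl i)) j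
    simpa [G', Matrix.toBlocks₁₂, Matrix.mul_apply, Matrix.one_apply] using h
  have h22 : G'.toBlocks₂₂ = Qᴴ := by
    ext i j
    have h := congrFun₂ hlast (splitEquiv hdn (.inr i)) j
    simpa [G', Matrix.toBlocks₂₂, Matrix.mul_apply, Matrix.one_apply] using h
  have hG' : G' = fromBlocks G'.toBlocks₁₁ 0 G'.toBlocks₂₁ Qᴴ := by
    rw [← h12, ← h22, fromBlocks_toBlocks]
  have hG'u : G'ᴴ * G' = 1 := by
    rw [Matrix.conjTranspose_submatrix, Matrix.submatrix_mul_equiv, hG,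
      Matrix.submatrix_one_equiv]
  obtain ⟨h11, h21⟩ := unitary_of_fromBlocks_zero (hG' ▸ hG'u)
  rw [h21, ← blockDiagTwo_submatrix hdn] at hG'
  have hGD : G = blockDiagTwo d n G'.toBlocks₁₁ Qᴴ := by
    have h := congrArg (fun X => X.submatrix (splitEquiv hdn).symm (splitEquiv hdn).symm) hG'
    simpa [G'] using h
  refine ⟨A, G'.toBlocks₁₁, Qᴴ, a, hA, h11, ?_, fun j _ => ?_, ?_⟩
  · rw [Matrix.conjTranspose_conjTranspose, mul_eq_one_comm.1 hQ]
  · by_cases h : j < n - d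
    · simpa only [a, dif_pos h] using ht ⟨j, h⟩
    · simpa only [a, dif_neg h] using ⟨le_rfl, Real.two_pi_pos.le⟩
  · rw [← hGD]
    change U = N * (Nᴴ * U)
    rw [← Matrix.mul_assoc, mul_eq_one_comm.1 hN, Matrix.one_mul]
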